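/- For every feasible solution of a Co-MAPF instance, the sum of costs satisfies SOC ≥ Σ_i min over all vertices u such that u is reachable from s i, u is reachable from b i, and g i is reachable from u (a set of vertices that is nonempty because v i itself belongs to it) of the quantity 2·max{d(a i, s i) + d(s i, u), d(b i, u)} + d(u, g i). In other words, the cost of an optimal set of meetings, computed per task while ignoring conflicts between agents, is a lower bound on the sum of costs of every feasible solution. -/

import Mathlib

/-- A trajectory of a graph: at each time step the agent either waits or
moves along an edge. -/
def IsTrajectory {V : Type*} (G : SimpleGraph V) (p : ℕ → V) : Prop :=
  ∀ t : ℕ, p (t + 1) = p t ∨ G.Adj (p t) (p (t + 1))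

/-- A Co-MAPF instance with `k` tasks on the graph `G`: initiator start
vertices `a`, executor start vertices `b`, task start vertices `s` and task
goal vertices `g`; the `2k` agent start vertices are pairwise distinct. -/
structure CoMAPF {V : Type*} (G : SimpleGraph V) (k : ℕ) where
  a : Fin k → V
  b : Fin k → V
  s : Fin k → V
  g : Fin k → V
  starts_distinct : Function.Injective (Sum.elim a b)

/-- A feasible solution of a Co-MAPF instance: trajectories `p i` (initiator)
and `q i` (executor) for each task `i`, a meeting vertex `v i` and meeting
time `T i`, a visit time `tau i ≤ T i` at which the initiator is at the task
start, and a finish time `F i ≥ T i` at which the executor is at the task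
goal.  Initiator `i` is active at times `0,…,T i` and executor `i` at times
`0,…,F i`; the solution is conflict-free (no vertex conflicts and no swap
conflicts between active agents), with the single exception that initiator
`i` and executor `i` both occupy `v i` at time `T i`. -/
structure CoSolution {V : Type*} (G : SimpleGraph V) {k : ℕ} (I : CoMAPF G k) where
  p : Fin k → ℕ → V
  q : Fin k → ℕ → V
  v : Fin k → V
  T : Fin k → ℕ
  tau : Fin k → ℕ
  F : Fin k → ℕ
  traj_p : ∀ i, IsTrajectory G (p i)
  traj_q : ∀ i, IsTrajectory G (q i)
  start_p : ∀ i, p i 0 = I.a i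
  start_q : ∀ i, q i 0 = I.b i
  meet_p : ∀ i, p i (T i) = v i
  meet_q : ∀ i, q i (T i) = v i
  tau_le : ∀ i, tau i ≤ T i
  visit : ∀ i, p i (tau i) = I.s i
  T_le_F : ∀ i, T i ≤ F i
  finish : ∀ i, q i (F i) = I.g i
  no_vertex_conflict_pp : ∀ i j t, i ≠ j → t ≤ T i → t ≤ T j → p i t ≠ p j t
  no_vertex_conflict_qq : ∀ i j t, i ≠ j → t ≤ F i → t ≤ F j → q i t ≠ q j t
  no_vertex_conflict_pq : ∀ i j t, t ≤ T i → t ≤ F j → p i t = q j t →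
    i = j ∧ t = T i
  no_swap_conflict_pp : ∀ i j t, i ≠ j → t + 1 ≤ T i → t + 1 ≤ T j →
    ¬(p i (t + 1) = p j t ∧ p j (t + 1) = p i t ∧ G.Adj (p i t) (p i (t + 1)))
  no_swap_conflict_qq : ∀ i j t, i ≠ j → t + 1 ≤ F i → t + 1 ≤ F j →
    ¬(q i (t + 1) = q j t ∧ q j (t + 1) = q i t ∧ G.Adj (q i t) (q i (t + 1)))
  no_swap_conflict_pq : ∀ i j t, t + 1 ≤ T i → t + 1 ≤ F j →
    ¬(p i (t + 1) = q j t ∧ q j (t + 1) = p i t ∧ G.Adj (p i t) (p i (t + 1)))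

/-- The sum of costs (SOC) of a solution. -/
def CoSolution.SOC {V : Type*} {G : SimpleGraph V} {k : ℕ} {I : CoMAPF G k}
    (sol : CoSolution G I) : ℕ :=
  ∑ i, (sol.T i + sol.F i)

theorem IsTrajectory.exists_walk_length_le {V : Type*} {G : SimpleGraph V} {p : ℕ → V}
    (hp : IsTrajectory G p) (m n : ℕ) :
    ∃ w : G.Walk (p m) (p (m + n)), w.length ≤ n := by
  induction n with
  | zero => exact ⟨.nil, le_rfl⟩
  | succ n ih =>
    obtain ⟨w, hw⟩ := ih
    rcases hp (m + n) with h | h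
    · exact ⟨w.copy rfl h.symm, by rw [SimpleGraph.Walk.length_copy]; omega⟩
    · exact ⟨w.concat h, by rw [SimpleGraph.Walk.length_concat]; omega⟩

theorem IsTrajectory.reachable_and_dist_le {V : Type*} {G : SimpleGraph V} {p : ℕ → V}
    (hp : IsTrajectory G p) {m n : ℕ} (hmn : m ≤ n) :
    G.Reachable (p m) (p n) ∧ G.dist (p m) (p n) ≤ n - m := by
  have hwalk := hp.exists_walk_length_le m (n - m)
  rw [Nat.add_sub_cancel' hmn] at hwalk
  obtain ⟨w, hw⟩ := hwalk
  exact ⟨w.reachable, (SimpleGraph.dist_le w).trans hw⟩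

/-- The cost of an optimal set of meetings, computed per task while ignoring
conflicts between agents, is a lower bound on the sum of costs of every
feasible solution. -/
theorem soc_meetings_lower_bound {V : Type*} [Fintype V] (G : SimpleGraph V)
    {k : ℕ} (I : CoMAPF G k) (sol : CoSolution G I) :
    ∑ i, sInf {c : ℕ | ∃ u : V, G.Reachable (I.s i) u ∧ G.Reachable (I.b i) u ∧
        G.Reachable u (I.g i) ∧
        c = 2 * max (G.dist (I.a i) (I.s i) + G.dist (I.s i) u)
              (G.dist (I.b i) u) + G.dist u (I.g i)}
      ≤ sol.SOC := by
  refine Finset.sum_le_sum fun i _ => ?_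
  have hs := (sol.traj_p i).reachable_and_dist_le (Nat.zero_le (sol.tau i))
  have hv := (sol.traj_p i).reachable_and_dist_le (sol.tau_le i)
  have hb := (sol.traj_q i).reachable_and_dist_le (Nat.zero_le (sol.T i))
  have hg := (sol.traj_q i).reachable_and_dist_le (sol.T_le_F i)
  rw [sol.start_p, sol.visit] at hs
  rw [sol.visit, sol.meet_p] at hv
  rw [sol.start_q, sol.meet_q] at hb
  rw [sol.meet_q, sol.finish] at hg
  refine le_trans (Nat.sInf_le ⟨sol.v i, hv.1, hb.1, hg.1, rfl⟩) ?_
  have := sol.tau_le i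
  have := sol.T_le_F i
  omega
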